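/- Let r, s be positive integers (not necessarily relatively prime) and let M be a nonnegative integer. Then, as an identity of rational functions in the indeterminates q and z: 1/(zq;q)_M = Σ_{(i,j)∈S} Σ_{m≥0} q^{(rm+i)(sm+j)} z^{rm+i} · (1/(zq;q)_{sm+j−1+δ_{i,0}+δ_{i,r}}) · [M + rm + i·δ_{j,s} − sm − j choose rm + i·δ_{j,s}]_q, where S = {(0,0)} ∪ {(i,j) : 1 ≤ i ≤ r, 1 ≤ j ≤ s, (i,j) ≠ (r,s)}, δ denotes the Kronecker delta, and each inner sum over m ≥ 0 is finite because the q-binomial factor vanishes once sm + j exceeds M + rm + i·δ_{j,s}. -/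

import Mathlib

noncomputable section

/-- The field of rational functions `ℚ(q, z)`; the variable indexed by `none` plays the
role of `q` and the variable indexed by `some 0` plays the role of `z`. -/
abbrev FF := FractionRing (MvPolynomial (Option (Fin 1)) ℚ)

/-- The indeterminate `q`. -/
def qv : FF :=
  algebraMap (MvPolynomial (Option (Fin 1)) ℚ) FF (MvPolynomial.X (none : Option (Fin 1)))

/-- The indeterminate `z`. -/
def zv : FF :=
  algebraMap (MvPolynomial (Option (Fin 1)) ℚ) FF (MvPolynomial.X (some 0))

/-- The q-Pochhammer symbol `(z; q)_M = ∏_{k=1}^M (1 - z q^{k-1})`. -/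
def qPoch {F : Type*} [CommRing F] (q z : F) (M : ℕ) : F :=
  ∏ k ∈ Finset.range M, (1 - z * q ^ k)

/-- The q-binomial `[x choose y]_q = (q;q)_x / ((q;q)_y (q;q)_{x-y})` for `0 ≤ y ≤ x`,
and `0` otherwise. -/
def qBinom {F : Type*} [Field F] (q : F) (x y : ℤ) : F :=
  if 0 ≤ y ∧ y ≤ x then qPoch q q x.toNat / (qPoch q q y.toNat * qPoch q q (x - y).toNat)
  else 0

section GeneralField

variable {F : Type*} [Field F]

lemma qPoch_succ {R : Type*} [CommRing R] (q z : R) (n : ℕ) :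
    qPoch q z (n + 1) = qPoch q z n * (1 - z * q ^ n) := by
  simp [qPoch, Finset.prod_range_succ]

lemma qPoch_ne_zero {q z : F} (h : ∀ k, 1 - z * q ^ k ≠ 0) (n : ℕ) : qPoch q z n ≠ 0 :=
  Finset.prod_ne_zero_iff.2 fun k _ => h k

/-- The generating function `[M - b + a choose a]_q` of partitions with at most `a` parts,
each at most `M - b`. -/
def boxGF (q : F) (M a b : ℕ) : F := qBinom q ((M : ℤ) + a - b) a

lemma boxGF_of_lt (q : F) {M a b : ℕ} (h : M < b) : boxGF q M a b = 0 := by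
  rw [boxGF, qBinom, if_neg (by omega)]

lemma boxGF_add (q : F) (n a b : ℕ) :
    boxGF q (b + n) a b = qPoch q q (n + a) / (qPoch q q a * qPoch q q n) := by
  rw [boxGF, qBinom, if_pos (by omega)]
  congr 3 <;> omega

lemma boxGF_zero {q : F} (hq : ∀ k, 1 - q * q ^ k ≠ 0) {M b : ℕ} (h : b ≤ M) :
    boxGF q M 0 b = 1 := by
  obtain ⟨n, rfl⟩ := Nat.exists_eq_add_of_le h
  have := qPoch_ne_zero hq n
  rw [boxGF_add]
  simpa [qPoch] using this

/-- The `q`-Pascal recurrence. -/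
lemma boxGF_pascal {q : F} (hq : ∀ k, 1 - q * q ^ k ≠ 0) (M a b : ℕ) :
    boxGF q M (a + 1) b = boxGF q M a b + q ^ (a + 1) * boxGF q M (a + 1) (b + 1) := by
  rcases lt_or_ge M b with h | h
  · simp [boxGF_of_lt q h, boxGF_of_lt q (Nat.lt_succ_of_lt h)]
  obtain ⟨n, rfl⟩ := Nat.exists_eq_add_of_le h
  have key := qPoch_ne_zero hq
  cases n with
  | zero =>
    rw [boxGF_of_lt q (by omega : b + 0 < b + 1), boxGF_add, boxGF_add]
    have h1 := key (a + 1)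
    have h2 := key a
    have h3 := key 0
    rw [zero_add, zero_add]
    field_simp
    ring
  | succ n =>
    rw [boxGF_add, boxGF_add, show b + (n + 1) = (b + 1) + n by ring, boxGF_add,
      show n + 1 + (a + 1) = (n + 1 + a) + 1 by ring, show n + (a + 1) = n + 1 + a by ring,
      qPoch_succ q q (n + 1 + a), qPoch_succ q q a, qPoch_succ q q n]
    have h1 := key (n + 1 + a)
    have h2 := key a
    have h3 := key n
    have h4 := hq a
    have h5 := hq n
    field_simp
    ring

/-- The generating function of partitions `λ` with parts at most `M` and, if `a` is positive,
`λ_a ≥ b`; in that case the summands are indexed by the value `c` of `λ_a`. -/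
def durfeeGF (q z : F) (M : ℕ) : ℕ → ℕ → F
  | 0, _ => (qPoch q (z * q) M)⁻¹
  | a + 1, b => ∑ c ∈ Finset.Ico b (M + 1),
      q ^ ((a + 1) * c) * z ^ (a + 1) * (qPoch q (z * q) c)⁻¹ * boxGF q M a c

lemma durfeeGF_of_lt (q z : F) {M a b : ℕ} (ha : 0 < a) (h : M < b) :
    durfeeGF q z M a b = 0 := by
  obtain ⟨a, rfl⟩ := Nat.exists_eq_succ_of_ne_zero ha.ne'
  simp [durfeeGF, Finset.Ico_eq_empty_of_le (Nat.succ_le_of_lt h)]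

lemma durfeeGF_succ_left (q z : F) (M a b : ℕ) :
    durfeeGF q z M (a + 1) b = q ^ ((a + 1) * b) * z ^ (a + 1) * (qPoch q (z * q) b)⁻¹ *
      boxGF q M a b + durfeeGF q z M (a + 1) (b + 1) := by
  rcases lt_or_ge M b with h | h
  · rw [durfeeGF_of_lt q z a.succ_pos h, durfeeGF_of_lt q z a.succ_pos (Nat.lt_succ_of_lt h),
      boxGF_of_lt q h]
    simp
  · rw [durfeeGF, Finset.sum_eq_sum_Ico_succ_bot (Nat.lt_succ_of_le h), durfeeGF]

variable {q z : F}

lemma durfeeGF_succ_row (hq : ∀ k, 1 - q * q ^ k ≠ 0) (hz : ∀ k, 1 - z * q * q ^ k ≠ 0)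
    (M a b : ℕ) :
    durfeeGF q z M (a + 1) (b + 1) = q ^ ((a + 1) * (b + 1)) * z ^ (a + 1) *
      (qPoch q (z * q) b)⁻¹ * boxGF q M (a + 1) (b + 1) + durfeeGF q z M (a + 2) (b + 1) := by
  induction hn : M - b generalizing b with
  | zero =>
    rw [durfeeGF_of_lt q z a.succ_pos (by omega), durfeeGF_of_lt q z (by omega) (by omega),
      boxGF_of_lt q (by omega)]
    simp
  | succ n ih =>
    rw [durfeeGF_succ_left, durfeeGF_succ_left q z M (a + 1), ih (b + 1) (by omega),
      boxGF_pascal hq M a (b + 1), qPoch_succ]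
    have h1 := qPoch_ne_zero hz b
    have h2 := hz b
    field_simp
    ring

lemma durfeeGF_zero_zero (hq : ∀ k, 1 - q * q ^ k ≠ 0) (hz : ∀ k, 1 - z * q * q ^ k ≠ 0)
    (M : ℕ) : durfeeGF q z M 0 0 = 1 + durfeeGF q z M 1 1 := by
  have h (n : ℕ) : (qPoch q (z * q) n)⁻¹ =
      1 + ∑ c ∈ Finset.Ico 1 (n + 1), q ^ c * z * (qPoch q (z * q) c)⁻¹ := by
    induction n with
    | zero => simp [qPoch]
    | succ n ih =>
      rw [Finset.sum_Ico_succ_top (by omega), ← add_assoc, ← ih, qPoch_succ]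
      have h1 := qPoch_ne_zero hz n
      have h2 := hz n
      field_simp
      ring
  rw [durfeeGF, durfeeGF, h]
  congr 1
  refine Finset.sum_congr rfl fun c hc => ?_
  rw [boxGF_zero hq (by simp at hc; omega)]
  simp

lemma durfeeGF_succ_diag (hq : ∀ k, 1 - q * q ^ k ≠ 0) (hz : ∀ k, 1 - z * q * q ^ k ≠ 0)
    (M a b : ℕ) (hab : a = 0 ∧ b = 0 ∨ 0 < a ∧ 0 < b) :
    durfeeGF q z M a b = q ^ (a * b) * z ^ a * (qPoch q (z * q) b)⁻¹ * boxGF q M a b +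
      durfeeGF q z M (a + 1) (b + 1) := by
  rcases hab with ⟨rfl, rfl⟩ | ⟨ha, hb⟩
  · rw [durfeeGF_zero_zero hq hz, boxGF_zero hq M.zero_le]
    simp [qPoch]
  · obtain ⟨a, rfl⟩ := Nat.exists_eq_succ_of_ne_zero ha.ne'
    obtain ⟨b, rfl⟩ := Nat.exists_eq_succ_of_ne_zero hb.ne'
    simp only [Nat.succ_eq_add_one]
    rw [durfeeGF_succ_row hq hz, durfeeGF_succ_left q z M (a + 1) (b + 1), qPoch_succ]
    have h1 := qPoch_ne_zero hz b
    have h2 := hz b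
    field_simp
    ring

/-- A geometric sum: partitions with `λ_{a+1} = b + 1`, split by the multiplicity of `b + 1` among
the rows `a + 1, …, a + r + 1`. -/
lemma sum_multiplicity (hz : ∀ k, 1 - z * q * q ^ k ≠ 0) (a b r : ℕ) :
    ∑ i ∈ Finset.Ico 1 (r + 1), q ^ ((a + i) * (b + 1)) * z ^ (a + i) * (qPoch q (z * q) b)⁻¹ +
      q ^ ((a + (r + 1)) * (b + 1)) * z ^ (a + (r + 1)) * (qPoch q (z * q) (b + 1))⁻¹ =
    q ^ ((a + 1) * (b + 1)) * z ^ (a + 1) * (qPoch q (z * q) (b + 1))⁻¹ := by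
  induction r with
  | zero => simp
  | succ r ih =>
    rw [← ih, Finset.sum_Ico_succ_top (by omega), add_assoc, qPoch_succ]
    congr 1
    have h1 := qPoch_ne_zero hz b
    have h2 := hz b
    field_simp
    ring

/-- The `(i, j)`-summand of the dissection, based at the rectangle with `a` rows and `b` columns. -/
def dissectionTerm (q z : F) (M r s a b i j : ℕ) : F :=
  q ^ ((a + i) * (b + j)) * z ^ (a + i) *
    (qPoch q (z * q) (b + j + (if i = 0 then 1 else 0) + (if i = r then 1 else 0) - 1))⁻¹ *
    boxGF q M (a + i * (if j = s then 1 else 0)) (b + j)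

lemma sum_dissectionTerm_column (hz : ∀ k, 1 - z * q * q ^ k ≠ 0) (M r s a b j : ℕ)
    (hj : 0 < j) (hjs : j < s) :
    ∑ i ∈ Finset.Icc 1 (r + 1), dissectionTerm q z M (r + 1) s a b i j =
      durfeeGF q z M (a + 1) (b + j) - durfeeGF q z M (a + 1) (b + j + 1) := by
  obtain ⟨j, rfl⟩ := Nat.exists_eq_succ_of_ne_zero hj.ne'
  rw [durfeeGF_succ_left, add_sub_cancel_right, Nat.succ_eq_add_one, ← add_assoc,
    ← sum_multiplicity hz a (b + j) r, add_mul, Finset.sum_mul,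
    ← Finset.Ico_succ_right_eq_Icc, Order.succ_eq_add_one, Finset.sum_Ico_succ_top (by omega)]
  congr 1
  · refine Finset.sum_congr rfl fun i hi => ?_
    rw [Finset.mem_Ico] at hi
    rw [dissectionTerm, if_neg (by omega), if_neg (by omega), if_neg (by omega)]
    simp [← add_assoc]
  · rw [dissectionTerm, if_neg (by omega), if_pos rfl, if_neg (by omega)]
    simp [← add_assoc]

lemma dissectionTerm_last_column (hq : ∀ k, 1 - q * q ^ k ≠ 0)
    (hz : ∀ k, 1 - z * q * q ^ k ≠ 0) (M r s a b i : ℕ) (hs : 0 < s) (hi : 0 < i) (hir : i < r) :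
    dissectionTerm q z M r s a b i s =
      durfeeGF q z M (a + i) (b + s) - durfeeGF q z M (a + i + 1) (b + s) := by
  obtain ⟨s, rfl⟩ := Nat.exists_eq_succ_of_ne_zero hs.ne'
  obtain ⟨i, rfl⟩ := Nat.exists_eq_succ_of_ne_zero hi.ne'
  rw [dissectionTerm, if_neg (by omega), if_neg (by omega), if_pos rfl]
  simp only [Nat.succ_eq_add_one, ← add_assoc]
  rw [durfeeGF_succ_row hq hz]
  simp [← add_assoc]

lemma sum_dissectionTerm (hq : ∀ k, 1 - q * q ^ k ≠ 0) (hz : ∀ k, 1 - z * q * q ^ k ≠ 0)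
    (M r s a b : ℕ) (hr : 0 < r) (hs : 0 < s) (hab : a = 0 ∧ b = 0 ∨ 0 < a ∧ 0 < b) :
    ∑ ij ∈ (Finset.range (r + 1) ×ˢ Finset.range (s + 1)).filter (fun ij => ij = (0, 0) ∨
        (1 ≤ ij.1 ∧ ij.1 ≤ r ∧ 1 ≤ ij.2 ∧ ij.2 ≤ s ∧ ij ≠ (r, s))),
      dissectionTerm q z M r s a b ij.1 ij.2 =
    durfeeGF q z M a b - durfeeGF q z M (a + r) (b + s) := by
  have hset : (Finset.range (r + 1) ×ˢ Finset.range (s + 1)).filter (fun ij => ij = (0, 0) ∨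
        (1 ≤ ij.1 ∧ ij.1 ≤ r ∧ 1 ≤ ij.2 ∧ ij.2 ≤ s ∧ ij ≠ (r, s))) =
      insert (0, 0) ((Finset.Icc 1 r ×ˢ Finset.Ico 1 s) ∪ (Finset.Ico 1 r ×ˢ {s})) := by
    ext ⟨i, j⟩
    simp only [Finset.mem_filter, Finset.mem_product, Finset.mem_range, Finset.mem_insert,
      Finset.mem_union, Finset.mem_Icc, Finset.mem_Ico, Finset.mem_singleton, Prod.mk.injEq, ne_eq]
    omega
  rw [hset, Finset.sum_insert (by simp), Finset.sum_union, Finset.sum_product_right,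
    Finset.sum_product]
  · obtain ⟨r, rfl⟩ := Nat.exists_eq_succ_of_ne_zero hr.ne'
    simp only [Nat.succ_eq_add_one, Finset.sum_singleton]
    have hcol : ∑ j ∈ Finset.Ico 1 s, ∑ i ∈ Finset.Icc 1 (r + 1),
          dissectionTerm q z M (r + 1) s a b i j =
        durfeeGF q z M (a + 1) (b + 1) - durfeeGF q z M (a + 1) (b + s) := by
      rw [← neg_sub, ← Finset.sum_Ico_sub (fun j => durfeeGF q z M (a + 1) (b + j)) hs,
        ← Finset.sum_neg_distrib]
      refine Finset.sum_congr rfl fun j hj => ?_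
      rw [Finset.mem_Ico] at hj
      rw [neg_sub]
      exact sum_dissectionTerm_column hz M r s a b j hj.1 hj.2
    have hrow : ∑ i ∈ Finset.Ico 1 (r + 1), dissectionTerm q z M (r + 1) s a b i s =
        durfeeGF q z M (a + 1) (b + s) - durfeeGF q z M (a + (r + 1)) (b + s) := by
      rw [← neg_sub, ← Finset.sum_Ico_sub (fun i => durfeeGF q z M (a + i) (b + s)) hr,
        ← Finset.sum_neg_distrib]
      refine Finset.sum_congr rfl fun i hi => ?_
      rw [Finset.mem_Ico] at hi
      rw [neg_sub]
      exact dissectionTerm_last_column hq hz M (r + 1) s a b i hs hi.1 hi.2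
    have hcorner : dissectionTerm q z M (r + 1) s a b 0 0 =
        durfeeGF q z M a b - durfeeGF q z M (a + 1) (b + 1) := by
      rw [durfeeGF_succ_diag hq hz M a b hab, dissectionTerm]
      simp
    rw [hcol, hrow, hcorner]
    ring
  · rw [Finset.disjoint_left]
    rintro ⟨i, j⟩ h1 h2
    simp only [Finset.mem_product, Finset.mem_Ico, Finset.mem_singleton] at h1 h2
    omega

/-- The dissection identity over any field in which the denominators do not vanish. -/
lemma qPoch_inv_eq_sum_dissectionTerm (hq : ∀ k, 1 - q * q ^ k ≠ 0)
    (hz : ∀ k, 1 - z * q * q ^ k ≠ 0) (r s : ℕ) (hr : 0 < r) (hs : 0 < s) (M : ℕ) :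
    (qPoch q (z * q) M)⁻¹ =
      ∑ ij ∈ (Finset.range (r + 1) ×ˢ Finset.range (s + 1)).filter (fun ij => ij = (0, 0) ∨
          (1 ≤ ij.1 ∧ ij.1 ≤ r ∧ 1 ≤ ij.2 ∧ ij.2 ≤ s ∧ ij ≠ (r, s))),
        ∑ᶠ m : ℕ, dissectionTerm q z M r s (r * m) (s * m) ij.1 ij.2 := by
  have hfin (i j : ℕ) : ∑ᶠ m : ℕ, dissectionTerm q z M r s (r * m) (s * m) i j =
      ∑ m ∈ Finset.range (M + 1), dissectionTerm q z M r s (r * m) (s * m) i j := by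
    refine finsum_eq_sum_of_support_subset _ fun m hm => ?_
    by_contra hlt
    rw [Finset.mem_coe, Finset.mem_range] at hlt
    refine hm (?_ : dissectionTerm q z M r s (r * m) (s * m) i j = 0)
    have := Nat.le_mul_of_pos_left m hs
    rw [dissectionTerm, boxGF_of_lt q (by omega), mul_zero]
  simp only [hfin]
  rw [Finset.sum_comm]
  have hstep (m : ℕ) : _ = durfeeGF q z M (r * m) (s * m) -
      durfeeGF q z M (r * (m + 1)) (s * (m + 1)) :=
    sum_dissectionTerm hq hz M r s (r * m) (s * m) hr hs (by
      rcases m.eq_zero_or_pos with rfl | hm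
      · simp
      · exact Or.inr ⟨Nat.mul_pos hr hm, Nat.mul_pos hs hm⟩)
  rw [Finset.sum_congr rfl fun m _ => hstep m,
    Finset.sum_range_sub' (fun m => durfeeGF q z M (r * m) (s * m)),
    durfeeGF_of_lt q z (Nat.mul_pos hr M.succ_pos) (Nat.le_mul_of_pos_left (M + 1) hs)]
  simp [durfeeGF]

end GeneralField

lemma one_sub_algebraMap_ne_zero {p : MvPolynomial (Option (Fin 1)) ℚ}
    (hp : MvPolynomial.constantCoeff p = 0) : (1 : FF) - algebraMap _ FF p ≠ 0 := by
  intro h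
  rw [← map_one (algebraMap (MvPolynomial (Option (Fin 1)) ℚ) FF), ← map_sub,
    FaithfulSMul.algebraMap_eq_zero_iff] at h
  simpa [hp] using congrArg MvPolynomial.constantCoeff h

/-- Andrews' generalized Durfee dissection identity.  For positive
integers `r, s` (not necessarily coprime) and `M ∈ ℤ≥0`, as rational functions in `q, z`:
`1/(zq;q)_M = Σ_{(i,j)∈S} Σ_{m≥0} q^{(rm+i)(sm+j)} z^{rm+i}
  ⬝ 1/(zq;q)_{sm+j-1+δ_{i,0}+δ_{i,r}} ⬝ [M+rm+i·δ_{j,s}-sm-j choose rm+i·δ_{j,s}]_q`,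
where `S = {(0,0)} ∪ {(i,j) : 1 ≤ i ≤ r, 1 ≤ j ≤ s, (i,j) ≠ (r,s)}`.  (The subscript
`sm+j-1+δ_{i,0}+δ_{i,r}` is written below with the `-1` last, which is harmless since
for every `(i,j) ∈ S` one has `j + δ_{i,0} + δ_{i,r} ≥ 1`; each inner sum over `m` has
finite support since the q-binomial vanishes once `sm + j` exceeds `M + rm + i·δ_{j,s}`.) -/
theorem andrews_generalized_durfee (r s : ℕ) (hr : 0 < r) (hs : 0 < s) (M : ℕ) :
    (qPoch qv (zv * qv) M)⁻¹ =
      ∑ ij ∈ (Finset.range (r + 1) ×ˢ Finset.range (s + 1)).filter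
          (fun ij => ij = (0, 0) ∨
            (1 ≤ ij.1 ∧ ij.1 ≤ r ∧ 1 ≤ ij.2 ∧ ij.2 ≤ s ∧ ij ≠ (r, s))),
        ∑ᶠ m : ℕ,
          qv ^ ((r * m + ij.1) * (s * m + ij.2)) * zv ^ (r * m + ij.1) *
          (qPoch qv (zv * qv)
            (s * m + ij.2 + (if ij.1 = 0 then 1 else 0) + (if ij.1 = r then 1 else 0)
              - 1))⁻¹ *
          qBinom qv
            ((M : ℤ) + r * m + ij.1 * (if ij.2 = s then 1 else 0) - s * m - ij.2)
            ((r * m + ij.1 * (if ij.2 = s then 1 else 0) : ℕ)) := by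
  have hq (k : ℕ) : 1 - qv * qv ^ k ≠ 0 := by
    rw [qv, ← map_pow, ← map_mul]
    exact one_sub_algebraMap_ne_zero (by simp)
  have hz (k : ℕ) : 1 - zv * qv * qv ^ k ≠ 0 := by
    rw [qv, zv, ← map_pow, ← map_mul, ← map_mul]
    exact one_sub_algebraMap_ne_zero (by simp)
  rw [qPoch_inv_eq_sum_dissectionTerm hq hz r s hr hs M]
  refine Finset.sum_congr rfl fun ij _ => finsum_congr fun m => ?_
  rw [dissectionTerm, boxGF]
  congr 2
  push_cast
  ring
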